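/- arXiv:2112.10610 — 2 statements merged into one kernel-verified Lean document; each statement's English description precedes it below -/
import Mathlib

section
/- Let p be a prime and n, k positive integers. The commutator subgroup of GL_n(ℤ/p^kℤ) equals SL_n(ℤ/p^kℤ), unless p = 2 and n = 2, in which case the commutator subgroup of GL_2(ℤ/2^kℤ) is strictly contained in SL_2(ℤ/2^kℤ). -/
namespace CommGL

open Matrix

/-- Elements that clear the columns: over a local ring, a subgroup of `SL` that contains all
transvections is everything.  Auxiliary step: clearing one column below and above a pivot `1`. -/
theorem clear_col {m : ℕ} {R : Type*} [CommRing R]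
    (H : Subgroup (SpecialLinearGroup (Fin m) R))
    (hH : ∀ (i j : Fin m) (hij : i ≠ j) (c : R), SpecialLinearGroup.transvection hij c ∈ H)
    (M : SpecialLinearGroup (Fin m) R) (k : Fin m) (hkk : M.1 k k = 1)
    (hM : ∀ j < k, ∀ i, M.1 i j = (1 : Matrix (Fin m) (Fin m) R) i j) (s : Finset (Fin m)) :
    ∃ h ∈ H, (∀ j < k, ∀ i, (h * M).1 i j = (1 : Matrix (Fin m) (Fin m) R) i j) ∧
      (h * M).1 k k = 1 ∧ (∀ i ∈ s, i ≠ k → (h * M).1 i k = 0) := by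
  induction s using Finset.induction_on with
  | empty => exact ⟨1, H.one_mem, by simpa using hM, by simpa using hkk, by simp⟩
  | insert a s ha ih =>
    obtain ⟨h, hh, h1, h2, h3⟩ := ih
    by_cases hak : a = k
    · refine ⟨h, hh, h1, h2, ?_⟩
      intro i hi hik
      rcases Finset.mem_insert.1 hi with rfl | hi
      · exact absurd hak hik
      · exact h3 i hi hik
    · set N := h * M with hN
      refine ⟨SpecialLinearGroup.transvection hak (-(N.1 a k)) * h, H.mul_mem (hH _ _ _ _) hh, ?_⟩
      rw [mul_assoc, ← hN]
      change (∀ j < k, ∀ i, (Matrix.transvection a k (-(N.1 a k)) * N.1) i j = _) ∧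
        (Matrix.transvection a k (-(N.1 a k)) * N.1) k k = 1 ∧
        (∀ i ∈ insert a s, i ≠ k → (Matrix.transvection a k (-(N.1 a k)) * N.1) i k = 0)
      refine ⟨?_, ?_, ?_⟩
      · intro j hj i
        by_cases hi : i = a
        · subst hi
          rw [transvection_mul_apply_same, h1 j hj i, h1 j hj k, one_apply_ne hj.ne']
          simp
        · rw [transvection_mul_apply_of_ne _ _ _ _ hi, h1 j hj i]
      · rw [transvection_mul_apply_of_ne _ _ _ _ (Ne.symm hak), h2]
      · intro i hi hik
        by_cases hia : i = a
        · subst hia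
          rw [transvection_mul_apply_same, h2]
          simp
        · rw [transvection_mul_apply_of_ne _ _ _ _ hia]
          exact h3 i (Finset.mem_of_mem_insert_of_ne hi hia) hik

/-- One row operation with source row `b ≥ k` keeps the first `k` columns. -/
theorem row_op {m : ℕ} {R : Type*} [CommRing R]
    (M : SpecialLinearGroup (Fin m) R) (k : Fin m)
    (hM : ∀ j < k, ∀ i, M.1 i j = (1 : Matrix (Fin m) (Fin m) R) i j)
    (a b : Fin m) (hab : a ≠ b) (hb : k ≤ b) (c : R) :
    ∀ j < k, ∀ i, (SpecialLinearGroup.transvection hab c * M).1 i j =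
      (1 : Matrix (Fin m) (Fin m) R) i j := by
  intro j hj i
  change (Matrix.transvection a b c * M.1) i j = _
  by_cases hi : i = a
  · subst hi
    rw [transvection_mul_apply_same, hM j hj i, hM j hj b, one_apply_ne (hj.trans_le hb).ne']
    simp
  · rw [transvection_mul_apply_of_ne _ _ _ _ hi, hM j hj i]

theorem exists_unit {m : ℕ} {R : Type*} [CommRing R] [IsLocalRing R]
    (M : SpecialLinearGroup (Fin m) R) (k : Fin m)
    (hM : ∀ j < k, ∀ i, M.1 i j = (1 : Matrix (Fin m) (Fin m) R) i j) :
    ∃ i, k ≤ i ∧ IsUnit (M.1 i k) := by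
  by_contra! hcon
  have hinv : (M⁻¹).1 * M.1 = 1 := congrArg Subtype.val (inv_mul_cancel M)
  have hz : ∀ i < k, (M⁻¹).1 k i = 0 := by
    intro i hi
    have h1 : ((M⁻¹).1 * M.1) k i = 0 := by rw [hinv, one_apply_ne hi.ne']
    rw [Matrix.mul_apply] at h1
    simpa [hM i hi, Matrix.one_apply] using h1
  have h1 : ∑ i, (M⁻¹).1 k i * M.1 i k = 1 := by
    rw [← Matrix.mul_apply, hinv, one_apply_eq]
  have h2 : (1 : R) ∈ IsLocalRing.maximalIdeal R := by
    rw [← h1]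
    refine Ideal.sum_mem _ fun i _ => ?_
    rcases lt_or_ge i k with hi | hi
    · rw [hz i hi]; simp
    · exact Ideal.mul_mem_left _ _ ((IsLocalRing.mem_maximalIdeal _).2 (hcon i hi))
  exact (IsLocalRing.mem_maximalIdeal _).1 h2 isUnit_one

theorem pivot {m : ℕ} {R : Type*} [CommRing R] [IsLocalRing R]
    (H : Subgroup (SpecialLinearGroup (Fin m) R))
    (hH : ∀ (i j : Fin m) (hij : i ≠ j) (c : R), SpecialLinearGroup.transvection hij c ∈ H)
    (M : SpecialLinearGroup (Fin m) R) (k : Fin m)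
    (hM : ∀ j < k, ∀ i, M.1 i j = (1 : Matrix (Fin m) (Fin m) R) i j) :
    ∃ h ∈ H, (∀ j < k, ∀ i, (h * M).1 i j = (1 : Matrix (Fin m) (Fin m) R) i j) ∧
      (h * M).1 k k = 1 := by
  have key : ∀ (M : SpecialLinearGroup (Fin m) R)
      (_ : ∀ j < k, ∀ i, M.1 i j = (1 : Matrix (Fin m) (Fin m) R) i j)
      (i : Fin m), k < i → IsUnit (M.1 i k) →
      ∃ h ∈ H, (∀ j < k, ∀ i, (h * M).1 i j = (1 : Matrix (Fin m) (Fin m) R) i j) ∧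
      (h * M).1 k k = 1 := by
    intro M hM i hi hu
    obtain ⟨u, hu⟩ := hu
    refine ⟨SpecialLinearGroup.transvection hi.ne ((1 - M.1 k k) * (u⁻¹ : Rˣ)), hH _ _ _ _,
      row_op M k hM _ _ _ hi.le _, ?_⟩
    change (Matrix.transvection k i ((1 - M.1 k k) * (u⁻¹ : Rˣ)) * M.1 :
      Matrix (Fin m) (Fin m) R) k k = 1
    rw [transvection_mul_apply_same, ← hu, mul_assoc]
    simp
  by_cases hex : ∃ i, k < i ∧ IsUnit (M.1 i k)
  · obtain ⟨i, hi, hu⟩ := hex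
    exact key M hM i hi hu
  · push Not at hex
    obtain ⟨i, hki, hu⟩ := exists_unit M k hM
    have hik : i = k := by
      by_contra hne
      exact hex i (lt_of_le_of_ne hki (Ne.symm hne)) hu
    subst hik
    by_cases hlast : ∃ b, i < b
    · obtain ⟨b, hb⟩ := hlast
      have hu' : IsUnit ((SpecialLinearGroup.transvection hb.ne' 1 * M).1 b i) := by
        change IsUnit ((Matrix.transvection b i (1 : R) * M.1) b i)
        rw [transvection_mul_apply_same, one_mul]
        by_contra hn
        have h1 := (IsLocalRing.mem_maximalIdeal _).2 hn
        have h2 := (IsLocalRing.mem_maximalIdeal _).2 (hex b hb)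
        have h3 := (Ideal.add_mem_iff_right _ h2).1 h1
        exact (IsLocalRing.mem_maximalIdeal _).1 h3 hu
      obtain ⟨h, hh, h1, h2⟩ := key _ (row_op M i hM _ _ hb.ne' le_rfl 1) b hb hu'
      refine ⟨h * SpecialLinearGroup.transvection hb.ne' 1, H.mul_mem hh (hH _ _ _ _), ?_⟩
      rw [mul_assoc]
      exact ⟨h1, h2⟩
    · push Not at hlast
      have hlt : ∀ j, j ≠ i → j < i := fun j hj => lt_of_le_of_ne (hlast j) hj
      refine ⟨1, H.one_mem, by simpa using hM, ?_⟩
      have htri : M.1.BlockTriangular id := by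
        intro a b hab
        have hab : b < a := hab
        rw [hM b (hab.trans_le (hlast a)) a, one_apply_ne hab.ne']
      have hdet := M.2
      rw [Matrix.det_of_upperTriangular htri, Finset.prod_eq_single i] at hdet
      · simpa using hdet
      · intro j _ hj
        rw [hM j (hlt j hj) j, one_apply_eq]
      · simp

theorem eq_top {m : ℕ} {R : Type*} [CommRing R] [IsLocalRing R]
    (H : Subgroup (SpecialLinearGroup (Fin m) R))
    (hH : ∀ (i j : Fin m) (hij : i ≠ j) (c : R), SpecialLinearGroup.transvection hij c ∈ H) :
    H = ⊤ := by
  rw [eq_top_iff]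
  intro M _
  have main : ∀ t : ℕ, t ≤ m → ∃ h ∈ H, ∀ j : Fin m, j.1 < t → ∀ i,
      (h * M).1 i j = (1 : Matrix (Fin m) (Fin m) R) i j := by
    intro t
    induction t with
    | zero => exact fun _ => ⟨1, H.one_mem, by simp⟩
    | succ t ih =>
      intro ht
      obtain ⟨h, hh, h1⟩ := ih (by omega)
      let k : Fin m := ⟨t, by omega⟩
      obtain ⟨g, hg, g1, g2⟩ := pivot H hH (h * M) k (fun j hj => h1 j hj)
      obtain ⟨f, hf, f1, f2, f3⟩ := clear_col H hH (g * (h * M)) k g2 g1 Finset.univ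
      refine ⟨f * (g * h), H.mul_mem hf (H.mul_mem hg hh), ?_⟩
      intro j hj i
      rw [mul_assoc, mul_assoc]
      by_cases hjk : j = k
      · rw [hjk]
        by_cases hik : i = k
        · rw [hik]; rw [f2, one_apply_eq]
        · rw [f3 i (Finset.mem_univ _) hik, one_apply_ne hik]
      · refine f1 j ?_ i
        have : j.1 ≠ t := fun h => hjk (Fin.ext h)
        exact Fin.lt_def.2 (by change j.1 < t; omega)
  obtain ⟨h, hh, h1⟩ := main m le_rfl
  have : h * M = 1 := Subtype.ext (Matrix.ext fun i j => h1 j j.2 i)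
  rw [← inv_eq_of_mul_eq_one_right this]
  exact H.inv_mem hh

theorem range_eq_ker {m : ℕ} {R : Type*} [CommRing R] :
    (SpecialLinearGroup.toGL : SpecialLinearGroup (Fin m) R →* GL (Fin m) R).range =
      (GeneralLinearGroup.det : GL (Fin m) R →* Rˣ).ker := by
  ext g
  constructor
  · rintro ⟨x, rfl⟩
    exact SpecialLinearGroup.coeToGL_det x
  · intro hg
    exact ⟨⟨g.1, congrArg Units.val hg⟩, Units.ext rfl⟩

theorem comm_le {m : ℕ} {R : Type*} [CommRing R] :
    commutator (GL (Fin m) R) ≤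
    (SpecialLinearGroup.toGL : SpecialLinearGroup (Fin m) R →* GL (Fin m) R).range := by
  rw [range_eq_ker]
  exact Abelianization.commutator_subset_ker _

theorem mem_comm_iff {G : Type*} [Group G] (x : G) :
    x ∈ commutator G ↔ Abelianization.of x = 1 := by
  rw [← Abelianization.ker_of, MonoidHom.mem_ker]

theorem transv_two {m : ℕ} {R : Type*} [CommRing R] (h2 : IsUnit (2 : R))
    (i j : Fin m) (hij : i ≠ j) (c : R) :
    SpecialLinearGroup.toGL (SpecialLinearGroup.transvection hij c) ∈ commutator (GL (Fin m) R) := by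
  obtain ⟨u, hu⟩ := h2
  let v : Fin m → Rˣ := Function.update 1 i u
  let D : GL (Fin m) R := ⟨diagonal fun a => (v a : R), diagonal fun a => ((v a)⁻¹ : Rˣ),
    by simp, by simp⟩
  set E := SpecialLinearGroup.toGL (SpecialLinearGroup.transvection hij c) with hE
  have hrel : D * E = E * E * D := by
    rw [hE, ← map_mul, ← SpecialLinearGroup.transvection_add]
    apply Units.ext
    change diagonal (fun a => (v a : R)) * Matrix.transvection i j c =
      Matrix.transvection i j (c + c) * diagonal (fun a => (v a : R))
    ext a b
    simp only [diagonal_mul, mul_diagonal, Matrix.transvection, Matrix.add_apply, v]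
    by_cases ha : a = i <;> by_cases hb : b = j
    · subst ha hb
      simp [hij, hij.symm, hu]; ring
    · subst ha
      by_cases hab : b = a
      · subst hab; simp [Ne.symm hb]
      · simp [Ne.symm hb, Matrix.one_apply_ne (Ne.symm hab)]
    · subst hb
      by_cases hab : a = b
      · subst hab; simp [Ne.symm ha, ha]
      · simp [Ne.symm ha, Matrix.one_apply_ne hab]
    · by_cases hab : a = b
      · subst hab; simp [Ne.symm ha, ha]
      · simp [Ne.symm ha, Matrix.one_apply_ne hab]
  rw [mem_comm_iff]
  have := congrArg Abelianization.of hrel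
  simp only [map_mul] at this
  rw [mul_comm, mul_left_inj] at this
  simpa using this

theorem transv_three {m : ℕ} {R : Type*} [CommRing R] (hm : 3 ≤ m)
    (i j : Fin m) (hij : i ≠ j) (c : R) :
    SpecialLinearGroup.toGL (SpecialLinearGroup.transvection hij c) ∈ commutator (GL (Fin m) R) := by
  obtain ⟨l, hl⟩ : ∃ l, l ∉ ({i, j} : Finset (Fin m)) := by
    by_contra! hcon
    have h1 := Finset.card_le_card (fun x _ => hcon x : Finset.univ ⊆ ({i, j} : Finset (Fin m)))
    have h2 := Finset.card_le_two (a := i) (b := j)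
    simp only [Finset.card_univ, Fintype.card_fin] at h1
    omega
  simp only [Finset.mem_insert, Finset.mem_singleton, not_or] at hl
  obtain ⟨hli, hlj⟩ := hl
  have hrel : SpecialLinearGroup.transvection (Ne.symm hli) c * SpecialLinearGroup.transvection hlj 1
      = SpecialLinearGroup.transvection hij c * (SpecialLinearGroup.transvection hlj 1 *
        SpecialLinearGroup.transvection (Ne.symm hli) c) := by
    apply Subtype.ext
    change Matrix.transvection i l c * Matrix.transvection l j 1 =
      Matrix.transvection i j c * (Matrix.transvection l j 1 * Matrix.transvection i l c)
    simp [Matrix.transvection, Matrix.add_mul, Matrix.mul_add, hij, hij.symm, hli, hlj,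
      Ne.symm hli, Ne.symm hlj]
    abel
  rw [mem_comm_iff]
  have := congrArg (fun x => Abelianization.of (SpecialLinearGroup.toGL x)) hrel
  simp only [map_mul] at this
  rw [mul_comm] at this
  simpa using this

theorem local_zmod (p k : ℕ) (hp : p.Prime) (hk : 0 < k) : IsLocalRing (ZMod (p ^ k)) := by
  haveI : Fact (1 < p ^ k) := ⟨Nat.one_lt_pow hk.ne' hp.one_lt⟩
  haveI : NeZero (p ^ k) := ⟨(pow_pos hp.pos k).ne'⟩
  have hu : ∀ a : ZMod (p ^ k), ¬ IsUnit a ↔ (ZMod.castHom (dvd_pow_self p hk.ne') (ZMod p)) a = 0 := by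
    intro a
    obtain ⟨a, rfl⟩ := ZMod.natCast_zmod_surjective a
    rw [ZMod.isUnit_iff_coprime, map_natCast, ZMod.natCast_eq_zero_iff,
      Nat.coprime_pow_right_iff hk, Nat.coprime_comm, hp.coprime_iff_not_dvd, not_not]
  refine IsLocalRing.of_nonunits_add fun a b ha hb => ?_
  rw [mem_nonunits_iff, hu] at *
  rw [map_add, ha, hb, add_zero]

/-- The sign character of `GL₂(𝔽₂) ≅ S₃`, as a polynomial in the entries. -/
def sgn (a b c d : ZMod 2) : ZMod 2 := a + d + 1 + a * d * (1 + b) * (1 + c)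

theorem sgn_mul : ∀ a b c d : ZMod 2, a * d - b * c ≠ 0 → ∀ e f g h : ZMod 2, e * h - f * g ≠ 0 →
    sgn (a * e + b * g) (a * f + b * h) (c * e + d * g) (c * f + d * h) =
      sgn a b c d + sgn e f g h := by
  decide

/-- The sign character as a homomorphism. -/
def sgnHom : GL (Fin 2) (ZMod 2) →* Multiplicative (ZMod 2) :=
  MonoidHom.mk' (fun A => Multiplicative.ofAdd (sgn (A.1 0 0) (A.1 0 1) (A.1 1 0) (A.1 1 1))) (by
    intro A B
    have hA : A.1 0 0 * A.1 1 1 - A.1 0 1 * A.1 1 0 ≠ 0 := by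
      rw [← Matrix.det_fin_two]; exact (GeneralLinearGroup.det A).ne_zero
    have hB : B.1 0 0 * B.1 1 1 - B.1 0 1 * B.1 1 0 ≠ 0 := by
      rw [← Matrix.det_fin_two]; exact (GeneralLinearGroup.det B).ne_zero
    rw [← ofAdd_add, ← sgn_mul _ _ _ _ hA _ _ _ _ hB]
    simp [Matrix.mul_apply, Fin.sum_univ_two])

theorem strict (k : ℕ) (hk : 0 < k) :
    commutator (GL (Fin 2) (ZMod (2 ^ k))) <
    (SpecialLinearGroup.toGL : SpecialLinearGroup (Fin 2) (ZMod (2 ^ k)) →*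
      GL (Fin 2) (ZMod (2 ^ k))).range := by
  refine lt_of_le_of_ne comm_le fun heq => ?_
  let f := sgnHom.comp (GeneralLinearGroup.map (n := Fin 2)
    (ZMod.castHom (dvd_pow_self 2 hk.ne') (ZMod 2)))
  let x : GL (Fin 2) (ZMod (2 ^ k)) := SpecialLinearGroup.toGL
    (SpecialLinearGroup.transvection (zero_ne_one : (0 : Fin 2) ≠ 1) 1)
  have hx : x ∈ commutator (GL (Fin 2) (ZMod (2 ^ k))) := heq ▸ ⟨_, rfl⟩
  have h1 : f x = 1 := Abelianization.commutator_subset_ker f hx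
  have h2 : f x = Multiplicative.ofAdd (sgn 1 1 0 1) := by
    let φ := ZMod.castHom (dvd_pow_self 2 hk.ne') (ZMod 2)
    let T : Matrix (Fin 2) (Fin 2) (ZMod (2 ^ k)) := 1 + Matrix.single 0 1 1
    change Multiplicative.ofAdd (sgn (φ (T 0 0)) (φ (T 0 1)) (φ (T 1 0)) (φ (T 1 1))) = _
    have e1 : T 0 0 = 1 := by simp [T]
    have e2 : T 0 1 = 1 := by simp [T]
    have e3 : T 1 0 = 0 := by simp [T]
    have e4 : T 1 1 = 1 := by simp [T]
    rw [e1, e2, e3, e4, map_one, map_zero]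
  rw [h2] at h1
  exact absurd h1 (by decide)

end CommGL

/-- For a prime `p` and positive integers `n, k`, the commutator subgroup of
`GL_n(ℤ/p^kℤ)` equals `SL_n(ℤ/p^kℤ)`, unless `p = 2` and `n = 2`, in which case it is
strictly contained in `SL_2(ℤ/2^kℤ)`. -/
theorem commutator_GL_eq_SL (p n k : ℕ) (hp : p.Prime) (hn : 0 < n) (hk : 0 < k) :
    (¬ (p = 2 ∧ n = 2) →
      commutator (Matrix.GeneralLinearGroup (Fin n) (ZMod (p ^ k))) =
        (Matrix.SpecialLinearGroup.toGL :
          Matrix.SpecialLinearGroup (Fin n) (ZMod (p ^ k)) →*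
            Matrix.GeneralLinearGroup (Fin n) (ZMod (p ^ k))).range) ∧
    ((p = 2 ∧ n = 2) →
      commutator (Matrix.GeneralLinearGroup (Fin n) (ZMod (p ^ k))) <
        (Matrix.SpecialLinearGroup.toGL :
          Matrix.SpecialLinearGroup (Fin n) (ZMod (p ^ k)) →*
            Matrix.GeneralLinearGroup (Fin n) (ZMod (p ^ k))).range) := by
  have hloc := CommGL.local_zmod p k hp hk
  constructor
  · intro hne
    refine le_antisymm CommGL.comm_le ?_
    have htop := CommGL.eq_top ((commutator
      (Matrix.GeneralLinearGroup (Fin n) (ZMod (p ^ k)))).comap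
        Matrix.SpecialLinearGroup.toGL) (by
      intro i j hij c
      rw [Subgroup.mem_comap]
      by_cases hn3 : 3 ≤ n
      · exact CommGL.transv_three hn3 i j hij c
      · have hij' : i.1 ≠ j.1 := fun h => hij (Fin.ext h)
        have hn2 : n = 2 := by omega
        have hp2 : p ≠ 2 := fun h => hne ⟨h, hn2⟩
        refine CommGL.transv_two ?_ i j hij c
        have h := (ZMod.isUnit_iff_coprime 2 (p ^ k)).2
          (Nat.Coprime.pow_right k ((Nat.coprime_primes Nat.prime_two hp).2 (Ne.symm hp2)))
        simpa using h)
    rintro _ ⟨x, rfl⟩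
    have hx : x ∈ (⊤ : Subgroup (Matrix.SpecialLinearGroup (Fin n) (ZMod (p ^ k)))) := trivial
    rw [← htop] at hx
    exact hx
  · rintro ⟨rfl, rfl⟩
    exact CommGL.strict k hk
end

section
/- Let n ≥ 2 and consider the polynomial ring ℤ[a_{ij}, b_{ij} : 1 ≤ i ≠ j ≤ n]. Define c_{ii} = 0 for all i; for i > j define c_{ij} = a_{ij} + b_{ij} + Σ_{i > r > j} a_{ir} b_{rj}; and for i < j define c_{ij} = a_{ij} + b_{ij} + Σ_{r < i} a_{ir} b_{rj} + Σ_{r > j} a_{ir} b_{rj}. Then the following identity holds in ℤ[a_{ij}, b_{ij}]: Σ_{1 ≤ i < j ≤ n} (a_{ij} b_{ji} + a_{ji} b_{ij}) + Σ_{i=2}^{n} (−1)^{i−1} Σ_{n ≥ j₁ > j₂ > … > j_i ≥ 1} ( c_{j₁ j₂} c_{j₂ j₃} ⋯ c_{j_{i−1} j_i} c_{j_i j₁} − a_{j₁ j₂} a_{j₂ j₃} ⋯ a_{j_{i−1} j_i} a_{j_i j₁} − b_{j₁ j₂} b_{j₂ j₃} ⋯ b_{j_{i−1} j_i} b_{j_i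 j₁} ) = 0. -/
open MvPolynomial

namespace Stmt4

variable (n : ℕ)

/-- The polynomial ring `ℤ[a_{ij}, b_{ij}]` (variables indexed by pairs; only the
off-diagonal ones are used). -/
abbrev R := MvPolynomial ((Fin n × Fin n) ⊕ (Fin n × Fin n)) ℤ

/-- The variable `a_{ij}` (set to `0` on the diagonal, which is never used). -/
noncomputable def a (i j : Fin n) : R n :=
  if i = j then 0 else X (Sum.inl (i, j))

/-- The variable `b_{ij}` (set to `0` on the diagonal, which is never used). -/
noncomputable def b (i j : Fin n) : R n :=
  if i = j then 0 else X (Sum.inr (i, j))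

/-- The entries `c_{ij}`: `c_{ii} = 0`; for `i > j`,
`c_{ij} = a_{ij} + b_{ij} + Σ_{i > r > j} a_{ir} b_{rj}`; for `i < j`,
`c_{ij} = a_{ij} + b_{ij} + Σ_{r < i} a_{ir} b_{rj} + Σ_{r > j} a_{ir} b_{rj}`. -/
noncomputable def c (i j : Fin n) : R n :=
  if i = j then 0
  else if j < i then
    a n i j + b n i j + ∑ r ∈ Finset.univ.filter (fun r => j < r ∧ r < i), a n i r * b n r j
  else
    a n i j + b n i j + ∑ r ∈ Finset.univ.filter (fun r => r < i), a n i r * b n r j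
      + ∑ r ∈ Finset.univ.filter (fun r => j < r), a n i r * b n r j

/-- The cyclic product `f_{j₁j₂} f_{j₂j₃} ⋯ f_{jᵢj₁}` along a list `[j₁, …, jᵢ]`. -/
noncomputable def cycProd (f : Fin n → Fin n → R n) (l : List (Fin n)) : R n :=
  ((l.zip (l.rotate 1)).map fun q => f q.1 q.2).prod

/-- The strictly decreasing list `j₁ > j₂ > … > jᵢ` enumerating a subset of `Fin n`. -/
def decList (s : Finset (Fin n)) : List (Fin n) :=
  (s.sort (· ≤ ·)).reverse

end Stmt4

namespace Stmt4

open Finset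

variable (n : ℕ)

/-- Product along a path starting at `x`, through `l`, ending at `z`. -/
noncomputable def path (f : Fin n → Fin n → R n) : Fin n → List (Fin n) → Fin n → R n
  | x, [], z => f x z
  | x, y :: l, z => f x y * path f y l z

theorem path_eq (f : Fin n → Fin n → R n) (x : Fin n) (l : List (Fin n)) (z : Fin n) :
    (((x :: l).zip (l ++ [z])).map fun q => f q.1 q.2).prod = path n f x l z := by
  induction l generalizing x with
  | nil => simp [path]
  | cons y l ih =>
    have := ih y
    simp only [List.cons_append, List.zip_cons_cons, List.map_cons, List.prod_cons, path] at this ⊢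
    rw [this]

theorem cycProd_cons (f : Fin n → Fin n → R n) (x : Fin n) (l : List (Fin n)) :
    cycProd n f (x :: l) = path n f x l x := by
  rw [← path_eq]
  simp [cycProd]

theorem decList_insert (x : Fin n) (s : Finset (Fin n)) (h : ∀ y ∈ s, y < x) :
    decList n (insert x s) = x :: decList n s := by
  have hx : x ∉ s := fun hx => lt_irrefl _ (h x hx)
  have : (insert x s).sort (· ≤ ·) = s.sort (· ≤ ·) ++ [x] := by
    apply List.Perm.eq_of_pairwise' (r := (· ≤ ·))
    · exact Finset.pairwise_sort _ _
    · rw [List.pairwise_append]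
      refine ⟨Finset.pairwise_sort _ _, by simp, ?_⟩
      intro a ha b hb
      simp only [Finset.mem_sort, List.mem_singleton] at ha hb
      subst hb
      exact (h a ha).le
    · rw [List.perm_ext_iff_of_nodup (Finset.sort_nodup _ _)]
      · intro a
        simp [or_comm]
      · rw [List.nodup_append]
        refine ⟨Finset.sort_nodup _ _, by simp, ?_⟩
        intro a ha b hb
        simp only [Finset.mem_sort, List.mem_singleton] at ha hb
        subst hb
        exact (h a ha).ne
  simp [decList, this]

theorem sum_powersetCard_succ (A : Finset (Fin n)) (k : ℕ) (h : List (Fin n) → R n) :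
    ∑ s ∈ powersetCard (k + 1) A, h (decList n s) =
      ∑ x ∈ A, ∑ s ∈ powersetCard k (A.filter (· < x)), h (x :: decList n s) := by
  rw [Finset.sum_sigma']
  symm
  refine Finset.sum_bij (fun p _ => insert p.1 p.2) ?_ ?_ ?_ ?_
  · rintro ⟨x, s⟩ hp
    simp only [mem_sigma, mem_powersetCard] at hp ⊢
    obtain ⟨hx, hs, hc⟩ := hp
    constructor
    · intro y hy
      rcases Finset.mem_insert.1 hy with rfl | hy
      · exact hx
      · exact (Finset.mem_filter.1 (hs hy)).1
    · rw [Finset.card_insert_of_notMem, hc]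
      intro hxs
      exact lt_irrefl _ (Finset.mem_filter.1 (hs hxs)).2
  · rintro ⟨x, s⟩ hp ⟨y, t⟩ hq heq
    simp only [mem_sigma, mem_powersetCard] at hp hq heq
    have hs : ∀ z ∈ s, z < x := fun z hz => (Finset.mem_filter.1 (hp.2.1 hz)).2
    have ht : ∀ z ∈ t, z < y := fun z hz => (Finset.mem_filter.1 (hq.2.1 hz)).2
    have h1 : x ∈ insert y t := heq ▸ Finset.mem_insert_self x s
    have h2 : y ∈ insert x s := heq ▸ Finset.mem_insert_self y t
    have hxy : x = y := by
      rcases Finset.mem_insert.1 h1 with h | h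
      · exact h
      · rcases Finset.mem_insert.1 h2 with h' | h'
        · exact h'.symm
        · exact absurd (hs _ h') (not_lt.2 (ht _ h).le)
    subst hxy
    have hxs : x ∉ s := fun h => lt_irrefl _ (hs x h)
    have hxt : x ∉ t := fun h => lt_irrefl _ (ht x h)
    have : s = t := by
      rw [← Finset.erase_insert hxs, heq, Finset.erase_insert hxt]
    rw [this]
  · intro s hs
    rw [mem_powersetCard] at hs
    have hne : s.Nonempty := by
      rw [← Finset.card_pos]; omega
    refine ⟨⟨s.max' hne, s.erase (s.max' hne)⟩, ?_, ?_⟩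
    · simp only [mem_sigma, mem_powersetCard]
      refine ⟨hs.1 (s.max'_mem hne), ?_, ?_⟩
      · intro y hy
        rw [Finset.mem_filter]
        exact ⟨hs.1 (Finset.mem_of_mem_erase hy), Finset.lt_max'_of_mem_erase_max' s hne hy⟩
      · rw [Finset.card_erase_of_mem (s.max'_mem hne)]; omega
    · exact Finset.insert_erase (s.max'_mem hne)
  · rintro ⟨x, s⟩ hp
    simp only [mem_sigma, mem_powersetCard] at hp
    rw [decList_insert]
    exact fun z hz => (Finset.mem_filter.1 (hp.2.1 hz)).2

/-- The matrix of `f`. -/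
noncomputable def mat (f : Fin n → Fin n → R n) : Matrix (Fin n) (Fin n) (R n) := Matrix.of f

/-- The strictly lower part. -/
noncomputable def low (f : Fin n → Fin n → R n) : Matrix (Fin n) (Fin n) (R n) :=
  Matrix.of fun i j => if j < i then f i j else 0

theorem sum_path (f : Fin n → Fin n → R n) (k : ℕ) (x z : Fin n) :
    ∑ s ∈ powersetCard k (univ.filter (· < x)), path n f x (decList n s) z =
      (low n f ^ k * mat n f) x z := by
  induction k generalizing x with
  | zero => simp [decList, path, mat]
  | succ k ih =>
    rw [sum_powersetCard_succ n _ k (fun l => path n f x l z), pow_succ', Matrix.mul_assoc,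
      Matrix.mul_apply, Finset.sum_filter]
    refine Finset.sum_congr rfl fun y _ => ?_
    by_cases hy : y < x
    · have : ((univ.filter (· < x)).filter (· < y)) = univ.filter (· < y) := by
        ext w
        simp only [mem_filter, mem_univ, true_and]
        exact ⟨fun h => h.2, fun h => ⟨h.trans hy, h⟩⟩
      rw [this, ← ih y, if_pos hy, Finset.mul_sum]
      simp [path, low, hy]
    · simp [low, hy]

theorem sum_cyc (f : Fin n → Fin n → R n) (k : ℕ) :
    ∑ s ∈ powersetCard (k + 1) (univ : Finset (Fin n)), cycProd n f (decList n s) =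
      (low n f ^ k * mat n f).trace := by
  rw [sum_powersetCard_succ n _ k (cycProd n f), Matrix.trace]
  refine Finset.sum_congr rfl fun x _ => ?_
  simp only [cycProd_cons, Matrix.diag_apply]
  exact sum_path n f k x x

theorem low_pow (f : Fin n → Fin n → R n) (k : ℕ) (x y : Fin n) (h : (x : ℕ) < y + k) :
    (low n f ^ k) x y = 0 := by
  induction k generalizing x with
  | zero =>
    have : x ≠ y := by rintro rfl; omega
    simp [Matrix.one_apply_ne this]
  | succ k ih =>
    rw [pow_succ', Matrix.mul_apply]
    refine Finset.sum_eq_zero fun w _ => ?_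
    by_cases hw : w < x
    · rw [ih w (by have : (w : ℕ) < x := hw; omega), mul_zero]
    · simp [low, hw]

/-- The inverse of `1 + low f`. -/
noncomputable def V (f : Fin n → Fin n → R n) : Matrix (Fin n) (Fin n) (R n) :=
  ∑ k ∈ range n, (-low n f) ^ k

theorem V_mul (f : Fin n → Fin n → R n) : V n f * (1 + low n f) = 1 := by
  have h0 : low n f ^ n = 0 := by
    ext1 x y
    exact low_pow n f n x y (by omega)
  have h := geom_sum_mul_neg (-low n f) n
  rw [neg_pow, h0, mul_zero, sub_zero, sub_neg_eq_add] at h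
  exact h

theorem V_upper (f : Fin n → Fin n → R n) (x y : Fin n) (h : x < y) : V n f x y = 0 := by
  rw [V, Matrix.sum_apply]
  refine Finset.sum_eq_zero fun k _ => ?_
  have h' : (x : ℕ) < y := h
  have : (-low n f) ^ k = (-1 : R n) ^ k • low n f ^ k := by
    rw [← smul_pow, neg_one_smul]
  rw [this, Matrix.smul_apply, low_pow n f k x y (by omega), smul_zero]

theorem V_diag (f : Fin n → Fin n → R n) (x : Fin n) : V n f x x = 1 := by
  rw [V, Matrix.sum_apply, Finset.sum_eq_single 0]
  · simp
  · intro k _ hk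
    have : (-low n f) ^ k = (-1 : R n) ^ k • low n f ^ k := by
      rw [← smul_pow, neg_one_smul]
    rw [this, Matrix.smul_apply, low_pow n f k x x (by omega), smul_zero]
  · intro h
    exact absurd (Finset.mem_range.2 (by have := x.2; omega)) h

theorem trace_V_mul (f : Fin n → Fin n → R n) (Y : Matrix (Fin n) (Fin n) (R n))
    (hY : ∀ i j, i < j → Y i j = 0) : (V n f * Y).trace = Y.trace := by
  refine Finset.sum_congr rfl fun x _ => ?_
  rw [Matrix.diag_apply, Matrix.diag_apply, Matrix.mul_apply, Finset.sum_eq_single x]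
  · rw [V_diag, one_mul]
  · intro y _ hy
    rcases lt_or_gt_of_ne hy with h | h
    · rw [hY _ _ h, mul_zero]
    · rw [V_upper _ _ _ _ h, zero_mul]
  · simp

theorem sum_all (f : Fin n → Fin n → R n) (hf : ∀ i, f i i = 0) (hn : 2 ≤ n) :
    ∑ i ∈ Icc 2 n, (-1 : R n) ^ (i - 1) *
      ∑ s ∈ powersetCard i (univ : Finset (Fin n)), cycProd n f (decList n s) =
    (V n f * mat n f).trace := by
  have h1 : ∀ k, ((-low n f) ^ k * mat n f).trace = (-1 : R n) ^ k *
      ∑ s ∈ powersetCard (k + 1) (univ : Finset (Fin n)), cycProd n f (decList n s) := by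
    intro k
    have : (-low n f) ^ k = (-1 : R n) ^ k • low n f ^ k := by
      rw [← smul_pow, neg_one_smul]
    rw [this, sum_cyc, Matrix.smul_mul, Matrix.trace_smul, smul_eq_mul]
  have h0 : (mat n f).trace = 0 := by
    simp [Matrix.trace, mat, hf]
  rw [V, Finset.sum_mul, Matrix.trace_sum]
  obtain ⟨m, rfl⟩ : ∃ m, n = m + 1 := ⟨n - 1, by omega⟩
  rw [Finset.sum_range_succ']
  simp only [pow_zero, one_mul, h0, add_zero]
  rw [← Finset.Ico_add_one_right_eq_Icc, Finset.sum_Ico_eq_sum_range]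
  refine Finset.sum_congr (by congr 1) fun k _ => ?_
  rw [h1, show 2 + k = k + 1 + 1 by omega, Nat.add_sub_cancel]

theorem low_c : (1 + low n (c n)) = (1 + low n (a n)) * (1 + low n (b n)) := by
  have : low n (c n) = low n (a n) + low n (b n) + low n (a n) * low n (b n) := by
    ext1 i j
    rw [Matrix.add_apply, Matrix.add_apply, Matrix.mul_apply]
    simp only [low, Matrix.of_apply]
    by_cases h : j < i
    · simp only [if_pos h, c, if_neg h.ne']
      congr 1
      rw [Finset.sum_filter]
      refine Finset.sum_congr rfl fun r _ => ?_
      by_cases h1 : j < r <;> by_cases h2 : r < i <;> simp [h1, h2]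
    · simp only [if_neg h, add_zero, zero_add]
      symm
      refine Finset.sum_eq_zero fun r _ => ?_
      by_cases h1 : r < i
      · have : ¬ j < r := fun h2 => h (h2.trans h1)
        simp [this]
      · simp [h1]
  rw [this]
  noncomm_ring

theorem V_c : V n (c n) = V n (b n) * V n (a n) := by
  have h1 := V_mul n (c n)
  have h2 : (1 + low n (c n)) * (V n (b n) * V n (a n)) = 1 := by
    rw [mul_eq_one_comm, low_c, Matrix.mul_assoc, ← Matrix.mul_assoc (V n (a n)), V_mul,
      Matrix.one_mul, V_mul]
  exact left_inv_eq_right_inv h1 h2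

theorem key : (V n (c n) * mat n (c n)).trace =
    (V n (a n) * mat n (a n)).trace + (V n (b n) * mat n (b n)).trace
      - (low n (a n) * mat n (b n)).trace - (mat n (a n) * low n (b n)).trace := by
  set M := (1 + low n (a n)) * mat n (b n) + mat n (a n) * (1 + low n (b n)) with hM
  have hX : ∀ i j, i < j → (M - mat n (c n)) i j = 0 := by
    intro i j h
    have : M = mat n (a n) + mat n (b n) + low n (a n) * mat n (b n)
        + mat n (a n) * low n (b n) := by
      rw [hM]; noncomm_ring
    rw [this, Matrix.sub_apply, sub_eq_zero, Matrix.add_apply, Matrix.add_apply,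
      Matrix.add_apply, Matrix.mul_apply, Matrix.mul_apply]
    simp only [mat, low, Matrix.of_apply, c, if_neg h.ne, if_neg h.not_gt, Finset.sum_filter,
      ite_mul, mul_ite, zero_mul, mul_zero]
  have h1 := trace_V_mul n (c n) _ hX
  have h2 : V n (c n) * M = V n (b n) * mat n (b n)
      + V n (b n) * (V n (a n) * mat n (a n) * (1 + low n (b n))) := by
    rw [hM, mul_add, V_c]
    congr 1
    · rw [← mul_assoc, mul_assoc (V n (b n)), V_mul, mul_one]
    · simp only [mul_assoc]
  have h3 : (V n (c n) * M).trace = (V n (b n) * mat n (b n)).trace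
      + (V n (a n) * mat n (a n)).trace := by
    rw [h2, Matrix.trace_add, Matrix.trace_mul_comm (V n (b n)) (_ * _), Matrix.mul_assoc,
      mul_eq_one_comm.1 (V_mul n (b n)), Matrix.mul_one]
  have ta : (mat n (a n)).trace = 0 := by simp [Matrix.trace, mat, a]
  have tb : (mat n (b n)).trace = 0 := by simp [Matrix.trace, mat, b]
  have tc : (mat n (c n)).trace = 0 := by simp [Matrix.trace, mat, c]
  have h4 : M.trace = (low n (a n) * mat n (b n)).trace + (mat n (a n) * low n (b n)).trace := by
    rw [hM, add_mul, mul_add, one_mul, mul_one, Matrix.trace_add, Matrix.trace_add,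
      Matrix.trace_add, ta, tb]
    ring
  rw [mul_sub, Matrix.trace_sub, Matrix.trace_sub, h3, h4, tc] at h1
  linear_combination -h1

theorem pairs : ∑ q ∈ univ.filter (fun q : Fin n × Fin n => q.1 < q.2),
        (a n q.1 q.2 * b n q.2 q.1 + a n q.2 q.1 * b n q.1 q.2) =
    (low n (a n) * mat n (b n)).trace + (mat n (a n) * low n (b n)).trace := by
  rw [Finset.sum_add_distrib, add_comm, Finset.sum_filter, Finset.sum_filter,
    Fintype.sum_prod_type_right, Fintype.sum_prod_type]
  simp only [Matrix.trace, Matrix.diag_apply, Matrix.mul_apply, mat, low, Matrix.of_apply,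
      ite_mul, mul_ite, zero_mul, mul_zero]

end Stmt4

open Stmt4 in
/-- The algebraic identity
`Σ_{i<j} (a_{ij} b_{ji} + a_{ji} b_{ij}) + Σ_{i=2}^{n} (−1)^{i−1}
Σ_{n ≥ j₁ > … > j_i ≥ 1} (c_{j₁j₂}⋯c_{j_ij₁} − a_{j₁j₂}⋯a_{j_ij₁} − b_{j₁j₂}⋯b_{j_ij₁}) = 0`
holds in `ℤ[a_{ij}, b_{ij} : 1 ≤ i ≠ j ≤ n]`, where the sum over strictly decreasing
sequences of length `i` is realized as a sum over subsets of `Fin n` of cardinality `i`,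
each enumerated in decreasing order. -/
theorem trace_determinant_identity (n : ℕ) (hn : 2 ≤ n) :
    (∑ q ∈ Finset.univ.filter (fun q : Fin n × Fin n => q.1 < q.2),
        (a n q.1 q.2 * b n q.2 q.1 + a n q.2 q.1 * b n q.1 q.2))
      + ∑ i ∈ Finset.Icc 2 n, (-1 : R n) ^ (i - 1) *
          ∑ s ∈ Finset.powersetCard i (Finset.univ : Finset (Fin n)),
            (cycProd n (c n) (decList n s) - cycProd n (a n) (decList n s)
              - cycProd n (b n) (decList n s)) = 0 := by
  have ha := sum_all n (a n) (by simp [a]) hn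
  have hb := sum_all n (b n) (by simp [b]) hn
  have hc := sum_all n (c n) (by simp [c]) hn
  simp only [Finset.sum_sub_distrib, mul_sub]
  rw [ha, hb, hc, key, pairs]
  ring
end
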